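/- Let R_0 = B_2 B_3 ⋯ B_n, with B_c = (c−1)(c−2)⋯1, be the staircase reduced word for the longest element w_0 ∈ S_n. Then for every triple 1 ≤ d < e < f ≤ n, one has T_{R_0}(d,e,f) = 1 and Θ_{R_0}(d,e,f) = −1. -/

import Mathlib

open scoped Classical

namespace BSDist

/-- The simple transposition `s i` (1-indexed): it swaps the values `i` and `i+1`
of `{1,…,n}`, i.e. the elements `i-1` and `i` of `Fin n`.  Out-of-range letters
give the identity. -/
def sTr (n : ℕ) (i : ℕ) : Equiv.Perm (Fin n) :=
  if h : 1 ≤ i ∧ i < n then Equiv.swap ⟨i - 1, by omega⟩ ⟨i, h.2⟩ else 1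

/-- The product `w(R) = s_{i₁} ⋯ s_{i_L}` of a word. -/
def wprod (n : ℕ) (R : List ℕ) : Equiv.Perm (Fin n) := (R.map (sTr n)).prod

/-- The Coxeter length of a permutation: its number of inversions. -/
def len {n : ℕ} (w : Equiv.Perm (Fin n)) : ℕ :=
  (Finset.univ.filter (fun p : Fin n × Fin n => p.1 < p.2 ∧ w p.2 < w p.1)).card

/-- A word over the alphabet `{1,…,n-1}`. -/
def Alphabet (n : ℕ) (R : List ℕ) : Prop := ∀ i ∈ R, 1 ≤ i ∧ i < n

/-- `R` is a reduced word (over the alphabet `{1,…,n-1}`). -/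
def IsReducedWord (n : ℕ) (R : List ℕ) : Prop :=
  Alphabet n R ∧ R.length = len (wprod n R)

/-- `R` is a reduced word for `w`. -/
def IsReducedWordFor (n : ℕ) (R : List ℕ) (w : Equiv.Perm (Fin n)) : Prop :=
  IsReducedWord n R ∧ wprod n R = w

/-- The weight `wt_R : S_n → ℤ[q]`, defined by the recursion
`wt_∅(e) = 1`, `wt_∅(x) = 0` for `x ≠ e`, and for an appended letter `i`:
`wt_{Ri}(x) = wt_R(x) + wt_R(x sᵢ)` if `ℓ(x sᵢ) > ℓ(x)`, and
`wt_{Ri}(x) = q·wt_R(x) + q·wt_R(x sᵢ)` if `ℓ(x sᵢ) < ℓ(x)`. -/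
noncomputable def wt (n : ℕ) (R : List ℕ) : Equiv.Perm (Fin n) → Polynomial ℤ :=
  R.foldl
    (fun f i x =>
      if len x < len (x * sTr n i) then f x + f (x * sTr n i)
      else Polynomial.X * f x + Polynomial.X * f (x * sTr n i))
    (fun x => if x = 1 then 1 else 0)

/-- A single commutation move: replace a consecutive factor `ij` by `ji` where
`|i - j| > 1`. -/
def CommMove (R R' : List ℕ) : Prop :=
  ∃ (A B : List ℕ) (i j : ℕ), (i + 1 < j ∨ j + 1 < i) ∧
    R = A ++ [i, j] ++ B ∧ R' = A ++ [j, i] ++ B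

/-- Commutation equivalence: a finite sequence of commutation moves. -/
def CommEquiv (R R' : List ℕ) : Prop := Relation.ReflTransGen CommMove R R'

/-- A single braid move: replace a consecutive factor `k(k+1)k` by `(k+1)k(k+1)`. -/
def BraidMove (R R' : List ℕ) : Prop :=
  ∃ (A B : List ℕ) (k : ℕ),
    R = A ++ [k, k + 1, k] ++ B ∧ R' = A ++ [k + 1, k, k + 1] ++ B

/-- The Demazure product of a word, computed left to right:
`w ∗ sᵢ = w sᵢ` if `ℓ(w sᵢ) > ℓ(w)`, and `w ∗ sᵢ = w` otherwise. -/
def dem (n : ℕ) (R : List ℕ) : Equiv.Perm (Fin n) :=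
  R.foldl (fun w i => if len w < len (w * sTr n i) then w * sTr n i else w) 1

/-- `app w t` is the value `w(t)` in 1-indexed one-line notation:
positions and values both run through `{1,…,n}`. -/
def app {n : ℕ} (w : Equiv.Perm (Fin n)) (t : ℕ) : ℕ :=
  if h : 1 ≤ t ∧ t ≤ n then ((w ⟨t - 1, by omega⟩ : Fin n) : ℕ) + 1 else 0

/-- `posOf x t = x⁻¹(t)`, the (1-indexed) position of the value `t` in `x`. -/
def posOf {n : ℕ} (x : Equiv.Perm (Fin n)) (t : ℕ) : ℕ := app x⁻¹ t

/-- The longest element `w₀` of `S_n` (the order-reversing permutation). -/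
def w0 (n : ℕ) : Equiv.Perm (Fin n) := ⟨Fin.rev, Fin.rev, Fin.rev_rev, Fin.rev_rev⟩

/-- The value pair `(a,b)` (with `a < b`) is an inversion of `x`:
`x⁻¹(a) > x⁻¹(b)`. -/
def IsInversion {n : ℕ} (x : Equiv.Perm (Fin n)) (a b : ℕ) : Prop :=
  posOf x b < posOf x a

/-- `tau R a b` is the first time `k` at which the pair `(a,b)` is an inversion
of the prefix product `s_{i₁} ⋯ s_{i_k}`. -/
noncomputable def tau (n : ℕ) (R : List ℕ) (a b : ℕ) : ℕ :=
  sInf {k | IsInversion (wprod n (R.take k)) a b}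

/-- `T_R(a,b,c) = +1` if `τ_R(a,b) < τ_R(b,c)` and `-1` otherwise. -/
noncomputable def T (n : ℕ) (R : List ℕ) (a b c : ℕ) : ℤ :=
  if tau n R a b < tau n R b c then 1 else -1

/-- `Supp(x) = {t : pos_x(t) ≠ pos_{w₀}(t)}`. -/
noncomputable def Supp (n : ℕ) (x : Equiv.Perm (Fin n)) : Finset ℕ :=
  (Finset.Icc 1 n).filter (fun t => posOf x t ≠ posOf (w0 n) t)

/-- `Fwd(x) = {t : pos_x(t) < pos_{w₀}(t)}`. -/
noncomputable def Fwd (n : ℕ) (x : Equiv.Perm (Fin n)) : Finset ℕ :=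
  (Finset.Icc 1 n).filter (fun t => posOf x t < posOf (w0 n) t)

/-- `Bwd(x) = {t : pos_x(t) > pos_{w₀}(t)}`. -/
noncomputable def Bwd (n : ℕ) (x : Equiv.Perm (Fin n)) : Finset ℕ :=
  (Finset.Icc 1 n).filter (fun t => posOf (w0 n) t < posOf x t)

/-- `D_R(x)`: the coefficient of `q^{N-1}` in `wt_R(x)`, where `N = n(n-1)/2`. -/
noncomputable def D (n : ℕ) (R : List ℕ) (x : Equiv.Perm (Fin n)) : ℤ :=
  (wt n R x).coeff (n * (n - 1) / 2 - 1)

/-- `σ_b(x) = sign(pos_x(b) − pos_{w₀}(b)) ∈ {−1,0,+1}`. -/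
noncomputable def sigmaVal (n : ℕ) (b : ℕ) (x : Equiv.Perm (Fin n)) : ℤ :=
  Int.sign ((posOf x b : ℤ) - (posOf (w0 n) b : ℤ))

/-- `Θ_R(a,b,c) = Σ_{x : Supp(x) = [a,c]} D_R(x)·σ_b(x)`. -/
noncomputable def Theta (n : ℕ) (R : List ℕ) (a b c : ℕ) : ℤ :=
  ∑ x ∈ Finset.univ.filter (fun x : Equiv.Perm (Fin n) => Supp n x = Finset.Icc a c),
    D n R x * sigmaVal n b x

end BSDist

namespace BSDist

/-- The block `B_c = (c−1)(c−2)⋯1`. -/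
def stairBlock (c : ℕ) : List ℕ := (List.range (c - 1)).map (fun k => c - 1 - k)

/-- The staircase reduced word `R₀ = B₂ B₃ ⋯ B_n` for `w₀ ∈ S_n`. -/
def staircase (n : ℕ) : List ℕ :=
  ((List.range (n - 1)).map (fun k => stairBlock (k + 2))).flatten

lemma sTr_mul_self (n i : ℕ) : sTr n i * sTr n i = 1 := by
  unfold sTr
  split_ifs <;> simp

lemma sTr_inv (n i : ℕ) : (sTr n i)⁻¹ = sTr n i := by
  rw [inv_eq_iff_mul_eq_one, sTr_mul_self]

/-- The action of a simple transposition, on the level of naturals. -/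
lemma sTr_val {n i : ℕ} (h1 : 1 ≤ i) (h2 : i < n) (p : Fin n) :
    ((sTr n i p : Fin n) : ℕ) =
      if (p : ℕ) = i - 1 then i else if (p : ℕ) = i then i - 1 else p := by
  unfold sTr
  rw [dif_pos ⟨h1, h2⟩, Equiv.swap_apply_def]
  simp only [Fin.ext_iff]
  split_ifs <;> rfl

lemma len_lt_of_asc {n i : ℕ} (h1 : 1 ≤ i) (h2 : i < n) (w : Equiv.Perm (Fin n))
    (h : w ⟨i - 1, by omega⟩ < w ⟨i, h2⟩) : len w < len (w * sTr n i) := by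
  unfold len
  set s := sTr n i with hs
  have hss : ∀ p, s (s p) = p := fun p => by
    rw [← Equiv.Perm.mul_apply, hs, sTr_mul_self]; rfl
  rw [← Finset.card_map (Equiv.prodCongr s s).toEmbedding]
  apply Finset.card_lt_card
  rw [Finset.ssubset_iff_of_subset]
  · refine ⟨(⟨i - 1, by omega⟩, ⟨i, h2⟩), ?_, ?_⟩
    · have e1 : s ⟨i - 1, by omega⟩ = ⟨i, h2⟩ := by
        apply Fin.ext; rw [hs, sTr_val h1 h2]; simp
      have e2 : s ⟨i, h2⟩ = ⟨i - 1, by omega⟩ := by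
        rw [← e1, hss]
      rw [Finset.mem_filter]
      refine ⟨Finset.mem_univ _, by rw [Fin.mk_lt_mk]; omega, ?_⟩
      change w (s _) < w (s _)
      rw [e1, e2]
      exact h
    · intro hm
      simp only [Finset.mem_map, Finset.mem_filter, Finset.mem_univ, true_and] at hm
      obtain ⟨⟨p, q⟩, ⟨hpq, hw⟩, he⟩ := hm
      simp only [Equiv.coe_toEmbedding, Equiv.prodCongr_apply, Prod.map, Prod.mk.injEq] at he
      have := sTr_val h1 h2 p
      have := sTr_val h1 h2 q
      rw [← hs, he.1] at *
      rw [he.2] at *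
      simp only [Fin.lt_def] at hpq
      simp only at *
      split_ifs at * <;> omega
  · intro x hm
    simp only [Finset.mem_map, Finset.mem_filter, Finset.mem_univ, true_and] at hm ⊢
    obtain ⟨⟨p, q⟩, ⟨hpq, hw⟩, rfl⟩ := hm
    simp only [Equiv.coe_toEmbedding, Equiv.prodCongr_apply, Prod.map, Equiv.Perm.mul_apply, hss]
    refine ⟨?_, hw⟩
    simp only [Fin.lt_def] at hpq ⊢
    rw [hs, sTr_val h1 h2, sTr_val h1 h2]
    have hne : ¬ ((p : ℕ) = i - 1 ∧ (q : ℕ) = i) := by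
      rintro ⟨hp, hq⟩
      have hp' : p = ⟨i - 1, by omega⟩ := Fin.ext hp
      have hq' : q = ⟨i, h2⟩ := Fin.ext hq
      rw [← hp', ← hq'] at h
      exact absurd hw (not_lt.2 h.le)
    split_ifs <;> omega

lemma len_lt_of_desc {n i : ℕ} (h1 : 1 ≤ i) (h2 : i < n) (w : Equiv.Perm (Fin n))
    (h : w ⟨i, h2⟩ < w ⟨i - 1, by omega⟩) : len (w * sTr n i) < len w := by
  have := len_lt_of_asc h1 h2 (w * sTr n i) ?_
  · rwa [mul_assoc, sTr_mul_self, mul_one] at this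
  · have e1 : sTr n i ⟨i - 1, by omega⟩ = ⟨i, h2⟩ := by
      apply Fin.ext; rw [sTr_val h1 h2]; simp
    have e2 : sTr n i ⟨i, h2⟩ = ⟨i - 1, by omega⟩ := by
      apply Fin.ext; rw [sTr_val h1 h2]; simp only; split_ifs <;> omega
    simpa only [Equiv.Perm.mul_apply, e1, e2] using h

lemma len_ne {n i : ℕ} (h1 : 1 ≤ i) (h2 : i < n) (w : Equiv.Perm (Fin n)) :
    len (w * sTr n i) ≠ len w := by
  rcases lt_trichotomy (w ⟨i - 1, by omega⟩) (w ⟨i, h2⟩) with h | h | h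
  · exact (len_lt_of_asc h1 h2 w h).ne'
  · have := w.injective h
    simp only [Fin.mk.injEq] at this
    omega
  · exact (len_lt_of_desc h1 h2 w h).ne

/-- The larger of `w`, `w sᵢ`. -/
def up (n : ℕ) (w : Equiv.Perm (Fin n)) (i : ℕ) : Equiv.Perm (Fin n) :=
  if len w < len (w * sTr n i) then w * sTr n i else w

/-- The smaller of `w`, `w sᵢ`. -/
def dn (n : ℕ) (w : Equiv.Perm (Fin n)) (i : ℕ) : Equiv.Perm (Fin n) :=
  if len w < len (w * sTr n i) then w else w * sTr n i

/-- Demazure product starting from `w`. -/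
def demR (n : ℕ) (R : List ℕ) (w : Equiv.Perm (Fin n)) : Equiv.Perm (Fin n) :=
  R.foldl (up n) w

/-- Results of all the one-defect paths. -/
def oms (n : ℕ) : List ℕ → Equiv.Perm (Fin n) → List (Equiv.Perm (Fin n))
  | [], _ => []
  | i :: R, w => demR n R (dn n w i) :: oms n R (up n w i)

/-- Weight computed from the front. -/
noncomputable def fwt (n : ℕ) : List ℕ → Equiv.Perm (Fin n) → Equiv.Perm (Fin n) → Polynomial ℤ
  | [], w, x => if x = w then 1 else 0
  | i :: R, w, x => Polynomial.X * fwt n R (up n w i) x + fwt n R (dn n w i) x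

lemma foldl_eq_fwt (n : ℕ) (R : List ℕ) (hR : Alphabet n R)
    (f : Equiv.Perm (Fin n) → Polynomial ℤ) (x : Equiv.Perm (Fin n)) :
    R.foldl
    (fun f i x =>
      if len x < len (x * sTr n i) then f x + f (x * sTr n i)
      else Polynomial.X * f x + Polynomial.X * f (x * sTr n i)) f x
      = ∑ w, f w * fwt n R w x := by
  induction R generalizing f with
  | nil => simp [fwt]
  | cons i R ih =>
    have hi := hR i (by simp)
    rw [List.foldl_cons, ih (fun j hj => hR j (by simp [hj]))]
    have key : ∀ w : Equiv.Perm (Fin n),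
        (if len w < len (w * sTr n i) then f w + f (w * sTr n i)
          else Polynomial.X * f w + Polynomial.X * f (w * sTr n i)) * fwt n R w x
        = (if len w < len (w * sTr n i) then 1 else Polynomial.X) * f w * fwt n R w x
          + (if len w < len (w * sTr n i) then 1 else Polynomial.X) * f (w * sTr n i)
            * fwt n R w x := by
      intro w; split_ifs <;> ring
    simp only [key]
    rw [Finset.sum_add_distrib]
    rw [← Equiv.sum_comp (Equiv.mulRight (sTr n i))
      (fun w => (if len w < len (w * sTr n i) then 1 else Polynomial.X) * f (w * sTr n i)
            * fwt n R w x)]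
    rw [← Finset.sum_add_distrib]
    apply Finset.sum_congr rfl
    intro w _
    simp only [Equiv.coe_mulRight, mul_assoc w, sTr_mul_self, mul_one, fwt, up, dn]
    have := len_ne hi.1 hi.2 w
    rcases lt_or_gt_of_ne this with h | h
    · rw [if_neg h.not_gt, if_pos h, if_neg h.not_gt, if_neg h.not_gt]; ring
    · rw [if_pos h, if_neg h.not_gt, if_pos h, if_pos h]; ring

lemma wt_eq_fwt (n : ℕ) (R : List ℕ) (hR : Alphabet n R) (x : Equiv.Perm (Fin n)) :
    wt n R x = fwt n R 1 x := by
  unfold wt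
  rw [foldl_eq_fwt n R hR]
  simp

lemma fwt_coeff_gt (n : ℕ) (R : List ℕ) (w x : Equiv.Perm (Fin n)) (k : ℕ)
    (hk : R.length < k) : (fwt n R w x).coeff k = 0 := by
  induction R generalizing w k with
  | nil =>
    simp only [fwt]
    split_ifs
    · rw [Polynomial.coeff_one]; simp at hk; simp; omega
    · simp
  | cons i R ih =>
    simp only [List.length_cons] at hk
    obtain ⟨k, rfl⟩ : ∃ m, k = m + 1 := ⟨k - 1, by omega⟩
    simp only [fwt, Polynomial.coeff_add, Polynomial.coeff_X_mul]
    rw [ih _ _ (by omega), ih _ _ (by omega), add_zero]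

lemma fwt_coeff_top (n : ℕ) (R : List ℕ) (w x : Equiv.Perm (Fin n)) :
    (fwt n R w x).coeff R.length = if x = demR n R w then 1 else 0 := by
  induction R generalizing w with
  | nil =>
    simp only [fwt, demR, List.foldl_nil, List.length_nil]
    split_ifs with h <;> simp [h]
  | cons i R ih =>
    simp only [fwt, Polynomial.coeff_add, List.length_cons, Polynomial.coeff_X_mul]
    rw [ih, fwt_coeff_gt _ _ _ _ _ (Nat.lt_succ_self _), add_zero]
    rfl

lemma fwt_coeff_sub (n : ℕ) (R : List ℕ) (w x : Equiv.Perm (Fin n)) (k : ℕ)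
    (hk : R.length = k + 1) :
    (fwt n R w x).coeff k = ((oms n R w).map (fun y => if x = y then (1 : ℤ) else 0)).sum := by
  induction R generalizing w k with
  | nil => simp at hk
  | cons i R ih =>
    simp only [List.length_cons, Nat.add_right_cancel_iff] at hk
    simp only [fwt, Polynomial.coeff_add, oms, List.map_cons, List.sum_cons]
    rw [← hk, fwt_coeff_top, add_comm]
    congr 1
    cases R with
    | nil => simp [oms]
    | cons j R =>
      rw [List.length_cons, Polynomial.coeff_X_mul, ih _ _ (by simp)]

/-- contribution of an element -/
noncomputable def contr (n d e f : ℕ) (y : Equiv.Perm (Fin n)) : ℤ :=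
  if Supp n y = Finset.Icc d f then sigmaVal n e y else 0

lemma Theta_eq (n d e f : ℕ) (R : List ℕ) (hR : Alphabet n R)
    (hl : R.length = n * (n - 1) / 2) (hp : 0 < R.length) :
    Theta n R d e f = ((oms n R 1).map (contr n d e f)).sum := by
  unfold Theta D
  have : ∀ x, (wt n R x).coeff (n * (n - 1) / 2 - 1)
      = ((oms n R 1).map (fun y => if x = y then (1 : ℤ) else 0)).sum := by
    intro x
    rw [wt_eq_fwt n R hR]
    apply fwt_coeff_sub
    omega
  simp only [this]
  rw [Finset.sum_filter]
  generalize oms n R 1 = l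
  induction l with
  | nil => simp
  | cons y l ih =>
    simp only [List.map_cons, List.sum_cons]
    rw [← ih]
    have : contr n d e f y = ∑ x, if x = y then contr n d e f x else 0 := by simp
    rw [this, ← Finset.sum_add_distrib]
    apply Finset.sum_congr rfl
    intro x _
    unfold contr
    split_ifs <;> ring

/-- `w` has position function `g`. -/
def St (n : ℕ) (w : Equiv.Perm (Fin n)) (g : ℕ → ℕ) : Prop :=
  ∀ t : Fin n, ((w⁻¹ t : Fin n) : ℕ) = g t

lemma step_iff {n i : ℕ} (h1 : 1 ≤ i) (h2 : i < n) {w : Equiv.Perm (Fin n)} {a b : Fin n}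
    (ha : ((w⁻¹ a : Fin n) : ℕ) = i - 1) (hb : ((w⁻¹ b : Fin n) : ℕ) = i) :
    len w < len (w * sTr n i) ↔ a < b := by
  have ha' : w ⟨i - 1, by omega⟩ = a := by
    rw [← Equiv.Perm.eq_inv_iff_eq]; exact Fin.ext ha.symm
  have hb' : w ⟨i, h2⟩ = b := by
    rw [← Equiv.Perm.eq_inv_iff_eq]; exact Fin.ext hb.symm
  constructor
  · intro h
    by_contra hn
    rcases (not_lt.1 hn).lt_or_eq with h' | h'
    · exact absurd (len_lt_of_desc h1 h2 w (by rw [ha', hb']; exact h')) h.not_gt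
    · subst h'; omega
  · intro h
    exact len_lt_of_asc h1 h2 w (by rw [ha', hb']; exact h)

lemma pos_mul {n i : ℕ} (h1 : 1 ≤ i) (h2 : i < n) (w : Equiv.Perm (Fin n)) (t : Fin n) :
    (((w * sTr n i)⁻¹ t : Fin n) : ℕ) =
      if ((w⁻¹ t : Fin n) : ℕ) = i - 1 then i
      else if ((w⁻¹ t : Fin n) : ℕ) = i then i - 1 else ((w⁻¹ t : Fin n) : ℕ) := by
  rw [mul_inv_rev, sTr_inv, Equiv.Perm.mul_apply, sTr_val h1 h2]

/-- The word `k (k-1) ⋯ 1`. -/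
def dsc : ℕ → List ℕ
  | 0 => []
  | k + 1 => (k + 1) :: dsc k

/-- The word `dsc m ++ dsc (m+1) ++ ⋯` with `L` blocks. -/
def rst : ℕ → ℕ → List ℕ
  | 0, _ => []
  | L + 1, m => dsc m ++ rst L (m + 1)

/-- Moving the value `M` at position `k` to the front. -/
lemma dsc_run {n : ℕ} (M k : ℕ) (hM : M < n) (hk : k ≤ M) (w : Equiv.Perm (Fin n)) (g : ℕ → ℕ)
    (hw : St n w g) (hgM : g M = k) (hge : ∀ t, M < t → g t = t) :
    demR n (dsc k) w = w * wprod n (dsc k) ∧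
    St n (demR n (dsc k) w) (fun t => if t = M then 0 else if g t < k then g t + 1 else g t) := by
  induction k generalizing w g with
  | zero =>
    refine ⟨by simp [dsc, demR, wprod], ?_⟩
    intro t
    simp only [dsc, demR, List.foldl_nil]
    rw [hw t]
    split_ifs with h1 h2
    · rw [h1]; exact hgM
    · omega
    · rfl
  | succ k ih =>
    have hkn : k + 1 < n := by omega
    set a : Fin n := w ⟨k, by omega⟩ with ha
    have ha' : ((w⁻¹ a : Fin n) : ℕ) = k + 1 - 1 := by simp [ha]
    have hga : g a = k := by rw [← hw a, ha']; rfl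
    have haM : (a : ℕ) < M := by
      by_contra hcon
      rcases (not_lt.1 hcon).lt_or_eq with h | h
      · have := hge _ h; omega
      · rw [← h] at hga; omega
    have hb' : ((w⁻¹ (⟨M, hM⟩ : Fin n) : Fin n) : ℕ) = k + 1 := by rw [hw]; exact hgM
    have hst := (step_iff (by omega) hkn ha' hb').2 haM
    have hup : up n w (k + 1) = w * sTr n (k + 1) := by
      unfold up; rw [if_pos hst]
    have hw2 : St n (w * sTr n (k + 1))
        (fun t => if g t = k then k + 1 else if g t = k + 1 then k else g t) := by
      intro t
      rw [pos_mul (by omega) hkn, hw t]; simp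
    have := ih (by omega) _ _ hw2 (by simp [hgM])
      (by intro t ht; have := hge t ht; split_ifs <;> omega)
    simp only [dsc, demR, List.foldl_cons] at *
    rw [hup]
    refine ⟨by rw [this.1, mul_assoc]; simp [wprod], ?_⟩
    intro t
    rw [this.2 t]
    simp only
    have hinj : g t = k + 1 → (t : ℕ) = M := by
      intro h
      have : w⁻¹ t = w⁻¹ ⟨M, hM⟩ := by
        apply Fin.ext; rw [hb', hw, h]
      rw [(w⁻¹).injective this]
    split_ifs <;> first | rfl | omega | (exfalso; omega) | skip
    all_goals (have := hinj (by omega); omega)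

lemma demR_append (n : ℕ) (A B : List ℕ) (w : Equiv.Perm (Fin n)) :
    demR n (A ++ B) w = demR n B (demR n A w) := by
  simp [demR, List.foldl_append]

lemma oms_append (n : ℕ) (A B : List ℕ) (w : Equiv.Perm (Fin n)) :
    oms n (A ++ B) w = (oms n A w).map (demR n B) ++ oms n B (demR n A w) := by
  induction A generalizing w with
  | nil => simp [oms, demR]
  | cons i A ih =>
    simp only [List.cons_append, oms, ih, List.map_cons, demR_append]
    rfl

lemma wprod_append (n : ℕ) (A B : List ℕ) : wprod n (A ++ B) = wprod n A * wprod n B := by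
  simp [wprod]

lemma St_congr {n : ℕ} {w : Equiv.Perm (Fin n)} {g h : ℕ → ℕ} (hw : St n w g)
    (hgh : ∀ t < n, g t = h t) : St n w h := fun t => by rw [hw t, hgh t t.2]

/-- Running `L` blocks, starting with the block moving value `M`. -/
lemma rst_run {n : ℕ} (L M : ℕ) (hM : M + L ≤ n) (w : Equiv.Perm (Fin n)) (g : ℕ → ℕ)
    (hw : St n w g) (hlt : ∀ t, t < M → g t < M) (hge : ∀ t, M ≤ t → g t = t) :
    demR n (rst L M) w = w * wprod n (rst L M) ∧
    St n (demR n (rst L M) w)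
      (fun t => if t < M then g t + L else if t < M + L then M + L - 1 - t else t) := by
  induction L generalizing w g M with
  | zero =>
    refine ⟨by simp [rst, demR, wprod], ?_⟩
    apply St_congr hw
    intro t _
    split_ifs with h1 h2
    · rfl
    · omega
    · exact hge t (by omega)
  | succ L ih =>
    obtain ⟨h1, h2⟩ := dsc_run M M (by omega) le_rfl w g hw (hge M le_rfl)
      (fun t ht => hge t ht.le)
    have := ih (M + 1) (by omega) _ _ h2
      (by
        intro t ht
        try simp only
        split_ifs with h3 h4
        · omega
        · omega
        · have := hlt t (by omega); omega)
      (by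
        intro t ht
        have := hge t (by omega)
        try simp only
        split_ifs <;> omega)
    simp only [rst, demR_append, wprod_append]
    refine ⟨by rw [this.1, h1, mul_assoc], ?_⟩
    apply St_congr this.2
    intro t ht
    try simp only
    rcases lt_trichotomy t M with h | h | h
    · have := hlt t h
      split_ifs <;> omega
    · split_ifs <;> omega
    · split_ifs <;> omega

/-- Position function in the middle of the block moving `m`: after `j` steps. -/
def vv (m j : ℕ) (t : ℕ) : ℕ :=
  if t < j then m - t else if t < m then m - 1 - t else if t = m then m - j else t

/-- Remaining letters of a block act trivially after a defect. -/
lemma dsc_stay {n m j k : ℕ} (hm : m < n) (hj : j < m) (hk : k + j + 1 ≤ m)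
    (w : Equiv.Perm (Fin n)) (hw : St n w (vv m j)) : demR n (dsc k) w = w := by
  induction k with
  | zero => rfl
  | succ k ih =>
    have ha : ((w⁻¹ (⟨m - 1 - k, by omega⟩ : Fin n) : Fin n) : ℕ) = k + 1 - 1 := by
      rw [hw]; simp only [vv]; split_ifs <;> omega
    have hb : ((w⁻¹ (⟨m - 2 - k, by omega⟩ : Fin n) : Fin n) : ℕ) = k + 1 := by
      rw [hw]; simp only [vv]; split_ifs <;> omega
    have hst := (step_iff (by omega) (by omega) ha hb).not.2
      (by rw [Fin.mk_lt_mk]; omega)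
    have hup : up n w (k + 1) = w := by unfold up; rw [if_neg hst]
    simp only [dsc, demR, List.foldl_cons] at *
    rw [hup, ih (by omega)]

lemma dsc_oms {n m : ℕ} (hm : m < n) (F : Equiv.Perm (Fin n) → ℤ) (φ : ℕ → ℤ)
    (hF : ∀ y j, j < m → St n y (vv m j) → F y = φ j) (k j : ℕ) (hk : k + j = m)
    (w : Equiv.Perm (Fin n)) (hw : St n w (vv m j)) :
    ((oms n (dsc k) w).map F).sum = ∑ i ∈ Finset.Ico j m, φ i := by
  induction k generalizing w j with
  | zero =>
    have : j = m := by omega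
    simp [dsc, oms, this]
  | succ k ih =>
    have ha : ((w⁻¹ (⟨j, by omega⟩ : Fin n) : Fin n) : ℕ) = k + 1 - 1 := by
      rw [hw]; simp only [vv]; split_ifs <;> omega
    have hb : ((w⁻¹ (⟨m, by omega⟩ : Fin n) : Fin n) : ℕ) = k + 1 := by
      rw [hw]; simp only [vv]; split_ifs <;> omega
    have hst := (step_iff (by omega) (by omega) ha hb).2
      (by rw [Fin.mk_lt_mk]; omega)
    have hup : up n w (k + 1) = w * sTr n (k + 1) := by unfold up; rw [if_pos hst]
    have hdn : dn n w (k + 1) = w := by unfold dn; rw [if_pos hst]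
    simp only [dsc, oms, List.map_cons, List.sum_cons, hup, hdn]
    rw [dsc_stay hm (by omega) (by omega) w hw, hF w j (by omega) hw,
      ih (j + 1) (by omega), Finset.sum_eq_sum_Ico_succ_bot (by omega : j < m)]
    intro t
    rw [pos_mul (by omega) (by omega), hw t]
    simp only [vv]
    split_ifs <;> omega

lemma rst_oms {n : ℕ} (F : Equiv.Perm (Fin n) → ℤ) (φ : ℕ → ℕ → ℤ)
    (hF : ∀ y m j, j < m → m < n → St n y (fun t => if t ≤ m then vv m j t + (n - 1 - m)
      else n - 1 - t) → F y = φ m j) (L m : ℕ) (hL : m + L = n)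
    (w : Equiv.Perm (Fin n)) (hw : St n w (vv m 0)) (hw2 : St n w (fun t => if t < m then m - 1 - t else t)) :
    ((oms n (rst L m) w).map F).sum = ∑ M ∈ Finset.Ico m n, ∑ j ∈ Finset.range M, φ M j := by
  induction L generalizing m w with
  | zero =>
    have : m = n := by omega
    simp [rst, oms, this]
  | succ L ih =>
    simp only [rst, oms_append, List.map_append, List.sum_append, List.map_map]
    rw [Finset.sum_eq_sum_Ico_succ_bot (by omega : m < n)]
    congr 1
    · rw [dsc_oms (m := m) (j := 0) (by omega) _ (φ m) _ m (by omega) w hw, Finset.range_eq_Ico]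
      intro y j hj hy
      apply hF _ m j hj (by omega)
      have := (rst_run L (m + 1) (by omega) y (vv m j) hy
        (by intro t ht; simp only [vv]; split_ifs <;> omega)
        (by intro t ht; simp only [vv]; split_ifs <;> omega)).2
      apply St_congr this
      intro t ht
      split_ifs <;> omega
    · have := (dsc_run m m (by omega) le_rfl w _ hw2 (by simp)
        (by intro t ht; split_ifs <;> omega)).2
      apply ih (m + 1) (by omega)
      · apply St_congr this
        intro t ht
        simp only [vv]
        split_ifs <;> omega
      · apply St_congr this
        intro t ht
        try simp only
        split_ifs <;> omega

lemma posOf_St {n : ℕ} {y : Equiv.Perm (Fin n)} {g : ℕ → ℕ} (hy : St n y g) {t : ℕ}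
    (h1 : 1 ≤ t) (h2 : t ≤ n) : posOf y t = g (t - 1) + 1 := by
  unfold posOf app
  rw [dif_pos ⟨h1, h2⟩, hy]

lemma St_w0 (n : ℕ) : St n (w0 n) (fun t => n - 1 - t) := by
  intro t
  have : ((w0 n)⁻¹ t : Fin n) = Fin.rev t := rfl
  rw [this, Fin.val_rev]; show n - (t + 1) = n - 1 - (t : ℕ); omega

lemma contr_eq {n d e f : ℕ} (hd : 1 ≤ d) (hde : d < e) (hef : e < f) (hf : f ≤ n)
    (y : Equiv.Perm (Fin n)) (m j : ℕ) (hj : j < m) (hm : m < n)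
    (hy : St n y (fun t => if t ≤ m then vv m j t + (n - 1 - m) else n - 1 - t)) :
    contr n d e f y = if m = f - 1 then (if j = d - 1 then -1 else 0) else 0 := by
  have hS : Supp n y = Finset.Icc (j + 1) (m + 1) := by
    ext t
    simp only [Supp, Finset.mem_filter, Finset.mem_Icc]
    constructor
    · rintro ⟨⟨h1, h2⟩, h3⟩
      rw [posOf_St hy h1 h2, posOf_St (St_w0 n) h1 h2] at h3
      by_contra hcon
      apply h3
      simp only [vv]
      split_ifs <;> omega
    · rintro ⟨h1, h2⟩
      refine ⟨by omega, ?_⟩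
      rw [posOf_St hy (by omega) (by omega), posOf_St (St_w0 n) (by omega) (by omega)]
      simp only [vv]
      split_ifs <;> omega
  unfold contr
  rw [hS]
  by_cases h : m = f - 1 ∧ j = d - 1
  · obtain ⟨rfl, rfl⟩ := h
    have h1 : d - 1 + 1 = d := by omega
    have h2 : f - 1 + 1 = f := by omega
    rw [h1, h2, if_pos rfl, if_pos rfl, if_pos rfl]
    unfold sigmaVal
    rw [posOf_St hy (by omega) (by omega), posOf_St (St_w0 n) (by omega) (by omega)]
    apply Int.sign_eq_neg_one_of_neg
    simp only [vv]
    split_ifs <;> omega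
  · rw [if_neg]
    · split_ifs <;> first | rfl | omega
    · intro heq
      have h1 : j + 1 ∈ Finset.Icc d f := by rw [← heq]; simp; omega
      have h2 : m + 1 ∈ Finset.Icc d f := by rw [← heq]; simp; omega
      have h3 : d ∈ Finset.Icc (j + 1) (m + 1) := by rw [heq]; simp; omega
      have h4 : f ∈ Finset.Icc (j + 1) (m + 1) := by rw [heq]; simp; omega
      simp only [Finset.mem_Icc] at *
      omega

lemma dsc_eq (k : ℕ) : stairBlock (k + 1) = dsc k := by
  induction k with
  | zero => rfl
  | succ k ih =>
    rw [dsc, ← ih]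
    simp only [stairBlock, Nat.add_sub_cancel, List.range_succ_eq_map, List.map_cons, List.map_map]
    congr 1
    apply List.map_congr_left
    intro a _
    simp

lemma rst_eq (L m : ℕ) :
    ((List.range L).map (fun k => stairBlock (k + m + 1))).flatten = rst L m := by
  induction L generalizing m with
  | zero => rfl
  | succ L ih =>
    rw [rst, ← ih, List.range_succ_eq_map, List.map_cons, List.flatten_cons, List.map_map]
    rw [← dsc_eq]
    congr 2
    · simp
    · apply List.map_congr_left
      intro a _
      simp only [Function.comp]
      congr 1
      omega

lemma staircase_eq (n : ℕ) : staircase n = rst (n - 1) 1 := by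
  rw [← rst_eq]; rfl

lemma dsc_mem {k i : ℕ} (h : i ∈ dsc k) : 1 ≤ i ∧ i ≤ k := by
  induction k with
  | zero => simp [dsc] at h
  | succ k ih =>
    simp only [dsc, List.mem_cons] at h
    rcases h with h | h
    · omega
    · have := ih h; omega

lemma rst_mem {L m i : ℕ} (h : i ∈ rst L m) : 1 ≤ i ∧ i < m + L := by
  induction L generalizing m with
  | zero => simp [rst] at h
  | succ L ih =>
    simp only [rst, List.mem_append] at h
    rcases h with h | h
    · have := dsc_mem h; omega
    · have := ih h; omega

lemma dsc_length (k : ℕ) : (dsc k).length = k := by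
  induction k with
  | zero => rfl
  | succ k ih => simp [dsc, ih]

lemma rst_length (L m : ℕ) : (rst L m).length * 2 = L * (2 * m + L - 1) := by
  induction L generalizing m with
  | zero => simp [rst]
  | succ L ih =>
    simp only [rst, List.length_append, dsc_length, add_mul, ih]
    have h1 : 2 * (m + 1) + L - 1 = 2 * m + L + 1 := by omega
    have h2 : 2 * m + (L + 1) - 1 = 2 * m + L := by omega
    rw [h1, h2]; ring

lemma rst_append (L K m : ℕ) : rst (L + K) m = rst L m ++ rst K (m + L) := by
  induction L generalizing m with
  | zero => simp [rst]
  | succ L ih =>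
    have h1 : L + 1 + K = (L + K) + 1 := by omega
    have h2 : m + (L + 1) = m + 1 + L := by omega
    rw [h1, rst, ih, rst, h2, List.append_assoc]

lemma St_one (n : ℕ) : St n 1 (fun t => t) := fun t => by simp

lemma wprod_rst (n L : ℕ) (hL : 1 + L ≤ n) :
    St n (wprod n (rst L 1)) (fun t => if t < 1 + L then L - t else t) := by
  obtain ⟨h1, h2⟩ := rst_run L 1 hL 1 _ (St_one n) (fun t ht => ht) (fun t _ => rfl)
  rw [h1, one_mul] at h2
  apply St_congr h2
  intro t _
  split_ifs <;> omega

lemma wprod_fix {n m : ℕ} (hm : m ≤ n) (R : List ℕ) (hR : ∀ i ∈ R, 1 ≤ i ∧ i < m) (t : Fin n)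
    (ht : m ≤ t) : (wprod n R)⁻¹ t = t := by
  induction R with
  | nil => simp [wprod]
  | cons i R ih =>
    have hi := hR i (by simp)
    have : wprod n (i :: R) = sTr n i * wprod n R := by simp [wprod]
    rw [this, mul_inv_rev, Equiv.Perm.mul_apply, sTr_inv]
    have : sTr n i t = t := by
      apply Fin.ext
      rw [sTr_val hi.1 (by omega)]
      split_ifs <;> omega
    rw [this, ih (fun j hj => hR j (by simp [hj]))]

lemma T_eq {n d e f : ℕ} (hd : 1 ≤ d) (hde : d < e) (hef : e < f) (hf : f ≤ n) :
    T n (staircase n) d e f = 1 := by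
  unfold T
  rw [if_pos]
  rw [staircase_eq]
  have hsplit : rst (n - 1) 1 = rst (e - 1) 1 ++ rst (n - e) e := by
    have := rst_append (e - 1) (n - e) 1
    rwa [show e - 1 + (n - e) = n - 1 by omega, show 1 + (e - 1) = e by omega] at this
  set K := (rst (e - 1) 1).length with hK
  have h1 : tau n (rst (n - 1) 1) d e ≤ K := by
    apply Nat.sInf_le
    simp only [Set.mem_ofPred_eq, IsInversion]
    rw [hsplit, hK, List.take_left]
    have := wprod_rst n (e - 1) (by omega)
    rw [posOf_St this (by omega) (by omega), posOf_St this (by omega) (by omega)]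
    split_ifs <;> omega
  refine lt_of_le_of_lt h1 ?_
  have hne : {k | IsInversion (wprod n ((rst (n - 1) 1).take k)) e f}.Nonempty := by
    refine ⟨(rst (n - 1) 1).length, ?_⟩
    simp only [Set.mem_ofPred_eq, IsInversion, List.take_length]
    have := wprod_rst n (n - 1) (by omega)
    rw [posOf_St this (by omega) (by omega), posOf_St this (by omega) (by omega)]
    split_ifs <;> omega
  have hmem := Nat.sInf_mem hne
  change IsInversion (wprod n ((rst (n - 1) 1).take (tau n (rst (n - 1) 1) e f))) e f at hmem
  by_contra hcon
  push Not at hcon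
  rw [hsplit, List.take_append_of_le_length (by rw [← hsplit]; exact hcon)] at hmem
  set Q := (rst (e - 1) 1).take (tau n (rst (e - 1) 1 ++ rst (n - e) e) e f)
  have hfix := fun t => wprod_fix (n := n) (m := e) (by omega) Q (fun i hi => by
    have := rst_mem (List.mem_of_mem_take hi); omega) t
  have hff := hfix ⟨f - 1, by omega⟩ (by simp; omega)
  unfold IsInversion posOf app at hmem
  rw [dif_pos (by omega), dif_pos (by omega), hff] at hmem
  have hee : e ≤ (((wprod n Q)⁻¹ ⟨e - 1, by omega⟩ : Fin n) : ℕ) := by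
    simp only at hmem; omega
  have h2 := hfix _ hee
  have h3 := (wprod n Q)⁻¹.injective h2
  rw [h3] at hee
  simp at hee
  omega

/-- For the staircase reduced word `R₀` of `w₀ ∈ S_n`
(`n ≥ 3`) and every triple `1 ≤ d < e < f ≤ n`, one has `T_{R₀}(d,e,f) = 1`
and `Θ_{R₀}(d,e,f) = −1`. -/
theorem staircase_T_and_Theta
    (n : ℕ) (hn : 3 ≤ n) (d e f : ℕ)
    (hd : 1 ≤ d) (hde : d < e) (hef : e < f) (hf : f ≤ n) :
    T n (staircase n) d e f = 1 ∧ Theta n (staircase n) d e f = -1 := by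
  refine ⟨T_eq hd hde hef hf, ?_⟩
  have hlen := rst_length (n - 1) 1
  rw [show 2 * 1 + (n - 1) - 1 = n by omega, mul_comm (n - 1) n] at hlen
  have hpos : 0 < n * (n - 1) := Nat.mul_pos (by omega) (by omega)
  rw [staircase_eq, Theta_eq]
  · rw [rst_oms (contr n d e f)
      (fun m j => if m = f - 1 then (if j = d - 1 then -1 else 0) else 0)
      (fun y m j hj hm hy => contr_eq hd hde hef hf y m j hj hm hy) (n - 1) 1 (by omega) 1]
    · rw [Finset.sum_eq_single (f - 1)]
      · rw [Finset.sum_eq_single (d - 1)]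
        · simp
        · intro b _ hb; simp [hb]
        · intro h; simp at h; omega
      · intro b _ hb; simp [hb]
      · intro h; simp at h; omega
    · apply St_congr (St_one n)
      intro t _
      simp only [vv]
      split_ifs <;> omega
    · apply St_congr (St_one n)
      intro t _
      split_ifs <;> omega
  · intro i hi
    have := rst_mem hi
    omega
  · omega
  · omega

end BSDist
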